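/- For every prime power q one has m_q ≤ (3/2)·m_{q^2}, and for every prime power q ≥ 4 one has m_q ≤ (5/3)·m_{q^3}. -/

import Mathlib

open Filter

/-- An `n`-code for `F_{q^k}` over `F_q`: an `F_q`-subspace `C ⊆ F_{q^k} × F_q^n` such
that the `F_{q^k}`-component takes all values and the `F_q^n`-component determines it. -/
def IsNCodeE {F E : Type} [Field F] [Field E] [Algebra F E] {n : ℕ}
    (C : Submodule F (E × (Fin n → F))) : Prop :=
  (∀ s : E, ∃ c ∈ C, c.1 = s) ∧ (∀ c ∈ C, c.2 = 0 → c.1 = 0)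

/-- The square `Ĉ = C^{*2}`: the `F_q`-span of all products `v ∗ v′` with `v, v′ ∈ C`,
where the product is the field product in `F_{q^k}` on the first component and
coordinatewise in `F_q^n`. -/
def codeSqE {F E : Type} [Field F] [Field E] [Algebra F E] {n : ℕ}
    (C : Submodule F (E × (Fin n → F))) : Submodule F (E × (Fin n → F)) :=
  Submodule.span F {x | ∃ a ∈ C, ∃ b ∈ C, x = a * b}

/-- There exists an `(n,k)`-multiplication-friendly code over `F_q`. -/
def MulFriendlyExists (q k n : ℕ) : Prop :=
  0 < n ∧ 0 < k ∧
    ∃ (F E : Type) (_ : Field F) (_ : Field E) (_ : Algebra F E)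
      (_ : Fintype F) (_ : Fintype E),
      Fintype.card F = q ∧ Fintype.card E = q ^ k ∧
        ∃ C : Submodule F (E × (Fin n → F)), IsNCodeE C ∧ IsNCodeE (codeSqE C)

/-- `μ_q(k)`: the smallest `n` for which an `(n,k)`-multiplication-friendly code over
`F_q` exists. -/
noncomputable def mu (q k : ℕ) : ℕ := sInf {n | MulFriendlyExists q k n}

/-- `M_q = limsup_{k→∞} μ_q(k)/k`. -/
noncomputable def Mlim (q : ℕ) : ℝ := limsup (fun k => (mu q k : ℝ) / (k : ℝ)) atTop

/-- `m_q = liminf_{k→∞} μ_q(k)/k`. -/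
noncomputable def mlim (q : ℕ) : ℝ := liminf (fun k => (mu q k : ℝ) / (k : ℝ)) atTop

open scoped TensorProduct

/-- The map `B` is a sum of `n` terms `(x, y) ↦ φ(x) φ(y) w` with `φ` a linear form. -/
def SymRankLE (F : Type*) {A M : Type*} [Field F] [AddCommGroup A] [Module F A]
    [AddCommGroup M] [Module F M] (B : A → A → M) (n : ℕ) : Prop :=
  ∃ (φ : Fin n → A →ₗ[F] F) (w : Fin n → M), ∀ x y, B x y = ∑ i, (φ i x * φ i y) • w i

namespace SymRankLE

section Module

variable {F A M : Type*} [Field F] [AddCommGroup A] [Module F A] [AddCommGroup M] [Module F M]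

theorem of_fintype {ι : Type*} [Fintype ι] {B : A → A → M} (φ : ι → A →ₗ[F] F) (w : ι → M)
    (h : ∀ x y, B x y = ∑ i, (φ i x * φ i y) • w i) : SymRankLE F B (Fintype.card ι) := by
  let e := (Fintype.equivFin ι).symm
  refine ⟨φ ∘ e, w ∘ e, fun x y => ?_⟩
  rw [h, ← e.sum_comp]
  rfl

theorem add {B B' : A → A → M} {n m : ℕ} (h : SymRankLE F B n) (h' : SymRankLE F B' m) :
    SymRankLE F (fun x y => B x y + B' x y) (n + m) := by
  obtain ⟨φ, w, h⟩ := h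
  obtain ⟨φ', w', h'⟩ := h'
  have := of_fintype (B := fun x y => B x y + B' x y) (Sum.elim φ φ') (Sum.elim w w')
    fun x y => by simp [h, h']
  simpa using this

theorem exists_sum {ι : Type*} (s : Finset ι) {B : ι → A → A → M}
    (h : ∀ i ∈ s, ∃ n, SymRankLE F (B i) n) :
    ∃ n, SymRankLE F (fun x y => ∑ i ∈ s, B i x y) n := by
  classical
  induction s using Finset.induction_on with
  | empty => exact ⟨0, Fin.elim0, Fin.elim0, by simp⟩
  | insert a s ha ih =>
    obtain ⟨n, hn⟩ := h a (by simp)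
    obtain ⟨m, hm⟩ := ih fun i hi => h i (by simp [hi])
    exact ⟨n + m, by simpa [Finset.sum_insert ha] using hn.add hm⟩

theorem square (f : A →ₗ[F] F) (w : M) : SymRankLE F (fun x y => (f x * f y) • w) 1 :=
  ⟨fun _ => f, fun _ => w, by simp⟩

theorem polarization (f g : A →ₗ[F] F) (w : M) :
    SymRankLE F (fun x y => (f x * g y + g x * f y) • w) 3 := by
  convert ((square (f + g) w).add (square f (-w))).add (square g (-w)) using 3
  simp only [LinearMap.add_apply]
  module

theorem exists_double_sum {ι : Type*} (s : Finset ι) (f : ι → A →ₗ[F] F) (w : ι → ι → M)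
    (hw : ∀ i j, w i j = w j i) :
    ∃ n, SymRankLE F (fun x y => ∑ i ∈ s, ∑ j ∈ s, (f i x * f j y) • w i j) n := by
  classical
  induction s using Finset.induction_on with
  | empty => exact ⟨0, Fin.elim0, Fin.elim0, by simp⟩
  | insert a s ha ih =>
    obtain ⟨n, hn⟩ := ih
    obtain ⟨m, hm⟩ := exists_sum s (B := fun j x y => (f a x * f j y + f j x * f a y) • w a j)
      fun j _ => ⟨3, polarization _ _ _⟩
    refine ⟨1 + m + n, ?_⟩
    convert ((square (f a) (w a a)).add hm).add hn using 3
    simp only [Finset.sum_insert ha, Finset.sum_add_distrib, add_smul, hw _ a]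
    abel

end Module

section Algebra

variable {F A : Type*} [Field F] [CommRing A] [Algebra F A]

theorem exists_mul [Module.Finite F A] : ∃ n, SymRankLE F (fun x y : A => x * y) n := by
  let b := Module.finBasis F A
  obtain ⟨n, hn⟩ := exists_double_sum Finset.univ (fun i => b.coord i) (fun i j => b i * b j)
    fun i j => mul_comm _ _
  refine ⟨n, ?_⟩
  convert hn using 3 with x y
  conv_lhs => rw [← b.sum_repr x, ← b.sum_repr y, Finset.sum_mul_sum]
  simp only [smul_mul_smul_comm, Module.Basis.coord_apply]

theorem of_surjective {B : Type*} [CommRing B] [Algebra F B] {n : ℕ}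
    (h : SymRankLE F (fun x y : A => x * y) n) (f : A →ₐ[F] B) (hf : Function.Surjective f) :
    SymRankLE F (fun x y : B => x * y) n := by
  obtain ⟨φ, w, h⟩ := h
  obtain ⟨s, hs⟩ := f.toLinearMap.exists_rightInverse_of_surjective (LinearMap.range_eq_top.2 hf)
  have hs' : ∀ x, f (s x) = x := fun x => LinearMap.congr_fun hs x
  refine ⟨fun i => φ i ∘ₗ s, fun i => f (w i), fun x y => ?_⟩
  have := congrArg f (h (s x) (s y))
  simpa [hs'] using this

theorem baseChange (K : Type*) [Field K] [Algebra F K] {n : ℕ}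
    (h : SymRankLE F (fun x y : A => x * y) n) :
    SymRankLE K (fun x y : K ⊗[F] A => x * y) n := by
  obtain ⟨φ, w, h⟩ := h
  refine ⟨fun i => (TensorProduct.AlgebraTensorModule.rid F K K).toLinearMap ∘ₗ
    (φ i).baseChange K, fun i => 1 ⊗ₜ w i, fun x y => ?_⟩
  induction x using TensorProduct.induction_on with
  | zero => simp
  | add x x' hx hx' => simp only [add_mul, hx, hx', map_add, add_smul, Finset.sum_add_distrib]
  | tmul a x =>
    induction y using TensorProduct.induction_on with
    | zero => simp
    | add y y' hy hy' => simp only [mul_add, hy, hy', map_add, add_smul, Finset.sum_add_distrib]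
    | tmul b y =>
      simp only [Algebra.TensorProduct.tmul_mul_tmul, h, TensorProduct.tmul_sum]
      refine Finset.sum_congr rfl fun i _ => ?_
      simp only [LinearMap.comp_apply, LinearMap.baseChange_tmul, LinearEquiv.coe_coe,
        TensorProduct.AlgebraTensorModule.rid_tmul, TensorProduct.smul_tmul', smul_eq_mul, mul_one,
        ← TensorProduct.smul_tmul]
      congr 1
      simp only [Algebra.smul_def, map_mul]
      ring

theorem tower (K : Type*) [Field K] [Algebra F K] [Algebra K A] [IsScalarTower F K A] {n m : ℕ}
    (h : SymRankLE K (fun x y : A => x * y) n) (hK : SymRankLE F (fun x y : K => x * y) m) :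
    SymRankLE F (fun x y : A => x * y) (n * m) := by
  obtain ⟨φ, w, h⟩ := h
  obtain ⟨ψ, v, hK⟩ := hK
  have := of_fintype (F := F) (B := fun x y : A => x * y)
    (fun p : Fin n × Fin m => ψ p.2 ∘ₗ (φ p.1).restrictScalars F) (fun p => v p.2 • w p.1)
    fun x y => by
      rw [show x * y = _ from h x y, Fintype.sum_prod_type]
      refine Finset.sum_congr rfl fun i _ => ?_
      rw [show φ i x * φ i y = _ from hK _ _, Finset.sum_smul]
      simp
  simpa using this

theorem ne_zero [Nontrivial A] {n : ℕ} (h : SymRankLE F (fun x y : A => x * y) n) : n ≠ 0 := by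
  rintro rfl
  obtain ⟨φ, w, h⟩ := h
  simpa using h 1 1

end Algebra

open Polynomial in
theorem mul_of_finrank {F K : Type*} [Field F] [Field K] [Algebra F K] [FiniteDimensional F K]
    [Algebra.IsSeparable F K] {d : ℕ} (hd : Module.finrank F K = d + 1) (s : Finset F)
    (hs : s.card = 2 * d) : SymRankLE F (fun x y : K => x * y) (2 * d + 1) := by
  classical
  let pb := Field.powerBasisOfFiniteOfSeparable F K
  have hdim : pb.dim = d + 1 := by rw [← pb.finrank, hd]
  let P : K →ₗ[F] F[X] := pb.basis.constr F fun i => X ^ (i : ℕ)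
  have hP : ∀ x, aeval pb.gen (P x) = x := by
    have : (aeval pb.gen).toLinearMap ∘ₗ P = LinearMap.id := by
      refine pb.basis.ext fun i => ?_
      rw [LinearMap.comp_apply, Module.Basis.constr_basis]
      simp
    exact fun x => LinearMap.congr_fun this x
  have hdeg : ∀ x, (P x).natDegree ≤ d := fun x => by
    simp only [P, Module.Basis.constr_apply_fintype]
    refine natDegree_sum_le_of_forall_le _ _ fun i _ => (natDegree_smul_le _ _).trans ?_
    have := i.2
    rw [natDegree_X_pow]
    omega
  let N : F[X] := Lagrange.nodal s id
  have key : ∀ p q : F[X], p.natDegree ≤ d → q.natDegree ≤ d →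
      p * q = C (p.coeff d * q.coeff d) * N +
        ∑ a ∈ s, C (p.eval a * q.eval a) * Lagrange.basis s id a := by
    intro p q hp hq
    have hcoeff : (p * q).coeff (2 * d) = p.coeff d * q.coeff d := by
      rw [two_mul, coeff_mul_add_eq_of_natDegree_le hp hq]
    have hN : N.coeff (2 * d) = 1 := by
      have h1 : N.Monic := Lagrange.nodal_monic
      have h2 : N.natDegree = 2 * d := by rw [← hs]; exact Lagrange.natDegree_nodal
      rw [← h2]; exact h1
    have hNd : N.natDegree ≤ 2 * d := by rw [← hs]; exact Lagrange.natDegree_nodal.le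
    have hlt : (p * q - C (p.coeff d * q.coeff d) * N).degree < s.card := by
      rw [hs, degree_lt_iff_coeff_zero]
      intro m hm
      rcases hm.eq_or_lt with rfl | hm
      · rw [coeff_sub, coeff_C_mul, hcoeff, hN, mul_one, sub_self]
      · rw [coeff_sub, coeff_C_mul, coeff_eq_zero_of_natDegree_lt (hNd.trans_lt hm),
          coeff_eq_zero_of_natDegree_lt]
        · simp
        · exact (natDegree_mul_le.trans (by omega)).trans_lt hm
    have := Lagrange.eq_interpolate_of_eval_eq (r := fun a => p.eval a * q.eval a) (v := id)
      (Set.injOn_id _) hlt fun a ha => by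
        have : N.eval a = 0 := Lagrange.eval_nodal_at_node (v := id) ha
        simp [this]
    rw [Lagrange.interpolate_apply] at this
    rw [← this]
    ring
  have := of_fintype (F := F) (B := fun x y : K => x * y)
    (fun o : Option s => o.elim (lcoeff F d ∘ₗ P) fun a => leval (a : F) ∘ₗ P)
    (fun o => o.elim (aeval pb.gen N) fun a => aeval pb.gen (Lagrange.basis s id (a : F)))
    fun x y => by
      conv_lhs => rw [← hP x, ← hP y, ← map_mul, key _ _ (hdeg x) (hdeg y)]
      simp [Fintype.sum_option, ← Finset.sum_coe_sort s, Algebra.smul_def]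
  simpa [hs] using this

end SymRankLE

theorem LinearMap.exists_comp_eq_of_ker_le {F V W U : Type*} [Field F] [AddCommGroup V] [Module F V]
    [AddCommGroup W] [Module F W] [AddCommGroup U] [Module F U] (f : V →ₗ[F] W) (g : V →ₗ[F] U)
    (h : ∀ v, f v = 0 → g v = 0) : ∃ l : W →ₗ[F] U, ∀ v, l (f v) = g v := by
  obtain ⟨s, hs⟩ := f.rangeRestrict.exists_rightInverse_of_surjective f.range_rangeRestrict
  obtain ⟨l, hl⟩ := (g ∘ₗ s).exists_extend
  refine ⟨l, fun v => ?_⟩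
  have h1 : l (f v) = g (s (f.rangeRestrict v)) := LinearMap.congr_fun hl (f.rangeRestrict v)
  have h2 : f (s (f.rangeRestrict v)) = f v :=
    congrArg Subtype.val (LinearMap.congr_fun hs (f.rangeRestrict v))
  rw [h1, ← sub_eq_zero, ← map_sub]
  exact h _ (by simp [h2])

theorem exists_code_iff_symRankLE {F E : Type} [Field F] [Field E] [Algebra F E] {n : ℕ} :
    (∃ C : Submodule F (E × (Fin n → F)), IsNCodeE C ∧ IsNCodeE (codeSqE C)) ↔
      SymRankLE F (fun x y : E => x * y) n := by
  constructor
  · rintro ⟨C, hC, hC2⟩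
    obtain ⟨s, hs⟩ := ((LinearMap.fst F E (Fin n → F)) ∘ₗ C.subtype).exists_rightInverse_of_surjective
      (LinearMap.range_eq_top.2 fun x => by
        obtain ⟨c, hc, rfl⟩ := hC.1 x
        exact ⟨⟨c, hc⟩, rfl⟩)
    have hs' : ∀ x, (s x : E × (Fin n → F)).1 = x := fun x => LinearMap.congr_fun hs x
    obtain ⟨l, hl⟩ := LinearMap.exists_comp_eq_of_ker_le
      (LinearMap.snd F E (Fin n → F) ∘ₗ (codeSqE C).subtype)
      (LinearMap.fst F E (Fin n → F) ∘ₗ (codeSqE C).subtype) fun v hv => hC2.2 v v.2 hv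
    refine ⟨fun i => LinearMap.proj i ∘ₗ LinearMap.snd F E (Fin n → F) ∘ₗ C.subtype ∘ₗ s,
      fun i => l fun j => if i = j then 1 else 0, fun x y => ?_⟩
    have := hl ⟨(s x : E × (Fin n → F)) * s y,
      Submodule.subset_span ⟨_, (s x).2, _, (s y).2, rfl⟩⟩
    simp only [LinearMap.comp_apply, Submodule.subtype_apply, LinearMap.snd_apply,
      LinearMap.fst_apply, Prod.fst_mul, Prod.snd_mul, hs'] at this
    exact this.symm.trans (LinearMap.pi_apply_eq_sum_univ l _)
  · rintro ⟨φ, w, h⟩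
    let C := LinearMap.range (LinearMap.prod LinearMap.id (LinearMap.pi φ))
    have hmem : ∀ x, (x, fun i => φ i x) ∈ C := fun x => ⟨x, rfl⟩
    have hsq : ∀ c ∈ codeSqE C, c.1 = ∑ i, c.2 i • w i := by
      intro c hc
      induction hc using Submodule.span_induction with
      | mem c hc =>
        obtain ⟨_, ⟨x, rfl⟩, _, ⟨y, rfl⟩, rfl⟩ := hc
        exact h x y
      | zero => simp
      | add a b _ _ ha hb => simp [ha, hb, add_smul, Finset.sum_add_distrib]
      | smul a b _ hb => simp [hb, Finset.smul_sum, mul_smul]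
    refine ⟨C, ⟨fun x => ⟨_, hmem x, rfl⟩, ?_⟩, fun x => ⟨(x, fun i => φ i x) * (1, fun i => φ i 1),
      Submodule.subset_span ⟨_, hmem x, _, hmem 1, rfl⟩, mul_one x⟩, fun c hc h0 => ?_⟩
    · rintro _ ⟨x, rfl⟩ h0
      have h0' : ∀ i, φ i x = 0 := fun i => congrFun h0 i
      have := h x x
      simpa [h0'] using this
    · rw [hsq c hc, h0]
      simp

theorem FiniteField.nonempty_ringHom_of_card_eq_pow (F K : Type*) [Field F] [Field K] [Finite F]
    [Finite K] {d : ℕ} (h : Nat.card K = Nat.card F ^ d) : Nonempty (F →+* K) := by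
  obtain ⟨p, hp⟩ := CharP.exists F
  have := Fact.mk (CharP.char_is_prime F p)
  let _ := ZMod.algebra F p
  have hF : Nat.card F = p ^ Module.finrank (ZMod p) F := by
    simpa using Module.natCard_eq_pow_finrank (K := ZMod p) (V := F)
  have hpK : CharP K p := by
    have := Fintype.ofFinite K
    obtain ⟨r, hr⟩ := CharP.exists K
    obtain ⟨m, hrp, hm⟩ := FiniteField.card K r
    rw [Fintype.card_eq_nat_card, h, hF, ← pow_mul] at hm
    have hdvd : r ∣ p := hrp.dvd_of_dvd_pow (hm ▸ dvd_pow_self r m.ne_zero)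
    rwa [(Nat.prime_dvd_prime_iff_eq hrp Fact.out).1 hdvd] at hr
  let _ := ZMod.algebra K p
  have hK : Nat.card K = p ^ Module.finrank (ZMod p) K := by
    simpa using Module.natCard_eq_pow_finrank (K := ZMod p) (V := K)
  rw [hF, hK, ← pow_mul] at h
  have := Nat.pow_right_injective (Fact.out : p.Prime).two_le h
  obtain ⟨f⟩ := FiniteField.nonempty_algHom_of_finrank_dvd (F := ZMod p) (K := F) (L := K)
    (this ▸ dvd_mul_right _ _)
  exact ⟨f⟩

theorem FiniteField.exists_extension (F : Type) [Field F] [Finite F] {d : ℕ} (hd : d ≠ 0) :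
    ∃ (K : Type) (_ : Field K) (_ : Algebra F K), Finite K ∧ Nat.card K = Nat.card F ^ d := by
  obtain ⟨p, hp⟩ := CharP.exists F
  have := Fact.mk (CharP.char_is_prime F p)
  have := NeZero.mk hd
  exact ⟨FiniteField.Extension F p d, inferInstance, inferInstance, inferInstance,
    FiniteField.natCard_extension F p d⟩

theorem IsPrimePow.exists_field {q : ℕ} (hq : IsPrimePow q) :
    ∃ (F : Type) (_ : Field F), Finite F ∧ Nat.card F = q := by
  obtain ⟨p, n, hp, hn, rfl⟩ := hq
  have := Fact.mk hp.nat_prime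
  exact ⟨GaloisField p n, inferInstance, inferInstance, GaloisField.card p n hn.ne'⟩

theorem mulFriendlyExists_iff {q k n : ℕ} : MulFriendlyExists q k n ↔ 0 < k ∧
    ∃ (F E : Type) (_ : Field F) (_ : Field E) (_ : Algebra F E), Finite F ∧ Finite E ∧
      Nat.card F = q ∧ Nat.card E = q ^ k ∧ SymRankLE F (fun x y : E => x * y) n := by
  constructor
  · rintro ⟨-, hk, F, E, _, _, _, _, _, hF, hE, hC⟩
    exact ⟨hk, F, E, _, _, _, inferInstance, inferInstance, by simpa using hF, by simpa using hE,
      exists_code_iff_symRankLE.1 hC⟩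
  · rintro ⟨hk, F, E, _, _, _, _, _, hF, hE, hS⟩
    exact ⟨Nat.pos_of_ne_zero hS.ne_zero, hk, F, E, _, _, _, Fintype.ofFinite F, Fintype.ofFinite E,
      by rwa [Fintype.card_eq_nat_card], by rwa [Fintype.card_eq_nat_card],
      exists_code_iff_symRankLE.2 hS⟩

theorem mulFriendlyExists_mu {q k : ℕ} (hq : IsPrimePow q) (hk : 0 < k) :
    MulFriendlyExists q k (mu q k) := by
  refine Nat.sInf_mem (s := {n | MulFriendlyExists q k n}) ?_
  obtain ⟨F, _, _, hF⟩ := hq.exists_field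
  obtain ⟨E, _, _, _, hE⟩ := FiniteField.exists_extension F hk.ne'
  obtain ⟨n, hn⟩ := SymRankLE.exists_mul (F := F) (A := E)
  exact ⟨n, mulFriendlyExists_iff.2 ⟨hk, F, E, _, _, _, inferInstance, inferInstance, hF,
    by rw [hE, hF], hn⟩⟩

theorem mu_le {q k n : ℕ} (h : MulFriendlyExists q k n) : mu q k ≤ n := Nat.sInf_le h

theorem mu_mul_le {q d k : ℕ} (hq : IsPrimePow q) (hdq : 2 * d ≤ q) (hk : 0 < k) :
    mu q (k * (d + 1)) ≤ mu (q ^ (d + 1)) k * (2 * d + 1) := by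
  obtain ⟨-, K, E, _, _, _, _, _, hK, hE, hS⟩ :=
    mulFriendlyExists_iff.1 (mulFriendlyExists_mu (hq.pow d.succ_ne_zero) hk)
  obtain ⟨F, _, _, hF⟩ := hq.exists_field
  obtain ⟨f⟩ := FiniteField.nonempty_ringHom_of_card_eq_pow F K (d := d + 1) (by rw [hK, hF])
  let _ : Algebra F K := f.toAlgebra
  let _ : Algebra F E := ((algebraMap K E).comp f).toAlgebra
  have : IsScalarTower F K E := .of_algebraMap_eq fun _ => rfl
  have hfin : Module.finrank F K = d + 1 := by
    have := Module.natCard_eq_pow_finrank (K := F) (V := K)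
    rw [hK, hF] at this
    exact (Nat.pow_right_injective hq.two_le this).symm
  have _ := Fintype.ofFinite F
  obtain ⟨s, -, hs⟩ := Finset.exists_subset_card_eq (s := (Finset.univ : Finset F)) (n := 2 * d)
    (by rwa [Finset.card_univ, Fintype.card_eq_nat_card, hF])
  exact mu_le <| mulFriendlyExists_iff.2 ⟨by positivity, F, E, _, _, _, inferInstance, inferInstance,
    hF, by rw [hE, ← pow_mul, mul_comm], hS.tower K (.mul_of_finrank hfin s hs)⟩

theorem exists_mu_pow_le {q d k : ℕ} (hq : IsPrimePow q) (hd : d ≠ 0) (hk : 0 < k) :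
    ∃ k', k ≤ d * k' ∧ mu (q ^ d) k' ≤ mu q k := by
  obtain ⟨-, F, E, _, _, _, _, _, hF, hE, hS⟩ :=
    mulFriendlyExists_iff.1 (mulFriendlyExists_mu hq hk)
  obtain ⟨K, _, _, _, hK⟩ := FiniteField.exists_extension F hd
  obtain ⟨m, hm⟩ := Ideal.exists_maximal (K ⊗[F] E)
  let _ := Ideal.Quotient.field m
  let L := (K ⊗[F] E) ⧸ m
  have : Finite (K ⊗[F] E) := Module.finite_of_finite F
  have : Finite L := Quotient.finite _
  have hKL := Module.natCard_eq_pow_finrank (K := K) (V := L)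
  rw [hK, hF] at hKL
  have hS' : SymRankLE K (fun x y : L => x * y) (mu q k) :=
    (hS.baseChange K).of_surjective (Ideal.Quotient.mkₐ K m) (Ideal.Quotient.mkₐ_surjective K m)
  have hEL : Nat.card E ≤ Nat.card L := Nat.card_le_card_of_injective
    ((Ideal.Quotient.mk m).comp
      (Algebra.TensorProduct.includeRight : E →ₐ[F] K ⊗[F] E).toRingHom)
    (RingHom.injective _)
  refine ⟨Module.finrank K L, ?_, mu_le <| mulFriendlyExists_iff.2 ⟨Module.finrank_pos, K, L, _, _, _,
    inferInstance, inferInstance, by rw [hK, hF], hKL, hS'⟩⟩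
  rw [hE, hKL, ← pow_mul] at hEL
  exact (Nat.pow_le_pow_iff_right hq.one_lt).1 hEL

theorem Real.liminf_eq_zero_of_tendsto_atTop {u : ℕ → ℝ} (hu : Tendsto u atTop atTop) :
    liminf u atTop = 0 := by
  have : {a | ∀ᶠ n in atTop, a ≤ u n} = Set.univ :=
    Set.eq_univ_of_forall fun a => hu.eventually_ge_atTop a
  rw [liminf_eq, this, Real.sSup_univ]

/-- Comparison of lower limits, including the case where both sequences diverge and
the lower limits take their default value. -/
theorem Real.liminf_le_const_mul_liminf {u v : ℕ → ℝ} {c C : ℝ} {g h : ℕ → ℕ} (hu : ∀ n, 0 ≤ u n)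
    (hc : 0 < c) (hC : 0 < C) (hg : Tendsto g atTop atTop) (hh : Tendsto h atTop atTop)
    (huv : ∀ᶠ n in atTop, u (h n) ≤ c * v n) (hvu : ∀ᶠ n in atTop, v (g n) ≤ C * u n) :
    liminf u atTop ≤ c * liminf v atTop := by
  by_cases hv : Tendsto v atTop atTop
  · have hu' : Tendsto u atTop atTop :=
      (tendsto_const_mul_atTop_of_pos hC).1 (tendsto_atTop_mono' _ hvu (hv.comp hg))
    rw [liminf_eq_zero_of_tendsto_atTop hu', liminf_eq_zero_of_tendsto_atTop hv, mul_zero]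
  · obtain ⟨b, hb⟩ : ∃ b, ∃ᶠ n in atTop, v n ≤ b := by
      simp only [tendsto_atTop, not_forall] at hv
      obtain ⟨b, hb⟩ := hv
      exact ⟨b, (Filter.not_eventually.1 hb).mono fun n hn => (not_le.1 hn).le⟩
    refine le_of_forall_lt_imp_le_of_dense fun a ha => ?_
    have hbdd : IsBoundedUnder (· ≥ ·) atTop u := isBoundedUnder_of ⟨0, hu⟩
    rw [← div_le_iff₀' hc]
    refine le_liminf_of_le (IsCoboundedUnder.of_frequently_le hb) ?_
    filter_upwards [hh.eventually (eventually_lt_of_lt_liminf ha hbdd), huv] with n hn hn'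
    exact (div_le_iff₀' hc).2 (hn.le.trans hn')

theorem mlim_le_mul_mlim_pow {q d : ℕ} (hq : IsPrimePow q) (hdq : 2 * d ≤ q) :
    mlim q ≤ ((2 * d + 1 : ℕ) / (d + 1 : ℕ) : ℝ) * mlim (q ^ (d + 1)) := by
  have hex : ∀ k, ∃ k', 0 < k → k ≤ (d + 1) * k' ∧ mu (q ^ (d + 1)) k' ≤ mu q k := fun k => by
    by_cases hk : 0 < k
    · obtain ⟨k', h⟩ := exists_mu_pow_le hq d.succ_ne_zero hk
      exact ⟨k', fun _ => h⟩
    · exact ⟨0, fun h => absurd h hk⟩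
  choose g hg using hex
  refine Real.liminf_le_const_mul_liminf (g := g) (h := fun k => k * (d + 1)) (C := (d + 1 : ℕ))
    (fun n => by positivity) (by positivity) (by positivity) ?_ ?_ ?_ ?_
  · refine tendsto_atTop.2 fun b => ?_
    filter_upwards [eventually_ge_atTop ((d + 1) * b + 1)] with k hk
    have := (hg k (by omega)).1
    exact Nat.le_of_mul_le_mul_left ((Nat.le_succ _).trans (hk.trans this)) d.succ_pos
  · exact tendsto_id.atTop_mul_const' (by omega)
  · filter_upwards [eventually_gt_atTop 0] with k hk
    have h : (mu q (k * (d + 1)) : ℝ) ≤ mu (q ^ (d + 1)) k * (2 * d + 1 : ℕ) :=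
      mod_cast mu_mul_le hq hdq hk
    rw [div_mul_div_comm, Nat.cast_mul, mul_comm (k : ℝ), mul_comm ((2 * d + 1 : ℕ) : ℝ)]
    gcongr
  · filter_upwards [eventually_gt_atTop 0] with k hk
    obtain ⟨h1, h2⟩ := hg k hk
    have hgk : 0 < g k := Nat.pos_of_ne_zero fun h => by simp [h] at h1; omega
    have h1' : (k : ℝ) ≤ (d + 1 : ℕ) * g k := mod_cast h1
    have h2' : (mu (q ^ (d + 1)) (g k) : ℝ) ≤ mu q k := mod_cast h2
    rw [← mul_div_assoc, div_le_div_iff₀ (by positivity) (by positivity)]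
    calc _ ≤ (mu q k : ℝ) * ((d + 1 : ℕ) * g k) := by gcongr
      _ = _ := by ring

/-- For every prime power `q`, `m_q ≤ (3/2) m_{q^2}`, and for every prime power `q ≥ 4`,
`m_q ≤ (5/3) m_{q^3}`. -/
theorem stmt7 (q : ℕ) (hq : IsPrimePow q) :
    mlim q ≤ (3 / 2 : ℝ) * mlim (q ^ 2) ∧
      (4 ≤ q → mlim q ≤ (5 / 3 : ℝ) * mlim (q ^ 3)) := by
  refine ⟨?_, fun h => ?_⟩
  · simpa using mlim_le_mul_mlim_pow (d := 1) hq hq.two_le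
  · simpa using mlim_le_mul_mlim_pow (d := 2) hq h
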